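/- Let S = (Δ_ij)_{i,j∈I} be an affine system of fans in a lattice N, with Δ_ii the fan of faces of σ(i). For each i ∈ I let R_i := {(ρ,i) : ρ a one-dimensional cone of Δ_ii}, set N' := ⊕_{i∈I} ℤ^{R_i} and Ñ := N ⊕ N', and for each ray ρ let v_ρ ∈ N denote its primitive lattice generator. Define Q : Ñ → N by Q(n, n') = n + Q'(n'), where Q' : N' → N sends the canonical basis vector e_{(ρ,i)} to v_ρ. Fix a total order ≤ on I and set Ĩ := {(τ,i,j) : i ≤ j in I, τ a maximal cone of Δ_ij}; for k = (τ,i,j) ∈ Ĩ let σ̃_k ⊆ Ñ_ℝ be the cone generated by the vectors e_{(ρ,l)} with l ∈ {i,j} and ρ a one-dimensional face of τ. Then for any k = (τ,i,j) and k' = (τ',i',j') in Ĩ: (a) if {i,j} ∩ {i',j'} = ∅ then Q_ℝ(σ̃_k ∩ σ̃_{k'}) = {0}, which lies in Δ_{ii'}; (b) if {i,j} ∩ {i',j'} ≠ ∅ then Q_ℝ(σ̃_k ∩ σ̃_{k'}) = τ ∩ τ', which lies in Δ_{ii'}. -/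

import Mathlib

open scoped TensorProduct Pointwise

/-- A (not necessarily strictly) convex cone, as a subset of a real vector space:
it contains `0` and is closed under addition and under scaling by nonnegative reals. -/
def IsConeSet {V : Type*} [AddCommGroup V] [Module ℝ V] (τ : Set V) : Prop :=
  (0 : V) ∈ τ ∧ (∀ x ∈ τ, ∀ y ∈ τ, x + y ∈ τ) ∧ ∀ c : ℝ, 0 ≤ c → ∀ x ∈ τ, c • x ∈ τ

/-- `τ` is a face of the convex cone `σ`:  a convex subcone such that whenever the sum of
two elements of `σ` lies in `τ`, both elements lie in `τ`. -/
def IsFaceOf {V : Type*} [AddCommGroup V] [Module ℝ V] (τ σ : Set V) : Prop :=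
  IsConeSet τ ∧ τ ⊆ σ ∧ ∀ x ∈ σ, ∀ y ∈ σ, x + y ∈ τ → x ∈ τ ∧ y ∈ τ

/-- The relative interior of a convex cone (algebraic formulation, which for polyhedral
cones in a finite dimensional space agrees with the topological relative interior). -/
def coneRelint {V : Type*} [AddCommGroup V] [Module ℝ V] (σ : Set V) : Set V :=
  { x | x ∈ σ ∧ ∀ y ∈ σ, ∃ ε : ℝ, 0 < ε ∧ x - ε • y ∈ σ }

/-- The real vector space `N_ℝ = ℝ ⊗_ℤ N` associated to a lattice `N`. -/
abbrev NR (N : Type*) [AddCommGroup N] : Type _ := ℝ ⊗[ℤ] N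

/-- The canonical map `N → N_ℝ`, `n ↦ 1 ⊗ n`. -/
noncomputable def toNR {N : Type*} [AddCommGroup N] (n : N) : NR N := (1 : ℝ) ⊗ₜ[ℤ] n

/-- A rational polyhedral cone in the lattice `N`: a cone in `N_ℝ` generated by finitely
many lattice vectors. -/
def IsRatCone {N : Type*} [AddCommGroup N] (σ : Set (NR N)) : Prop :=
  ∃ (m : ℕ) (v : Fin m → N),
    σ = { x | ∃ c : Fin m → ℝ, (∀ k, 0 ≤ c k) ∧ x = ∑ k, c k • toNR (v k) }

/-- A quasi-fan in the lattice `N`: a finite set of rational polyhedral cones, closed under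
passing to faces, in which any two members intersect in a common face of both. -/
def IsQuasiFan {N : Type*} [AddCommGroup N] (Sig : Set (Set (NR N))) : Prop :=
  Sig.Finite ∧ (∀ σ ∈ Sig, IsRatCone σ) ∧
    (∀ σ ∈ Sig, ∀ τ, IsFaceOf τ σ → τ ∈ Sig) ∧
    ∀ σ ∈ Sig, ∀ σ' ∈ Sig, IsFaceOf (σ ∩ σ') σ ∧ IsFaceOf (σ ∩ σ') σ'

/-- A fan: a quasi-fan all of whose cones are strictly convex. -/
def IsFan {N : Type*} [AddCommGroup N] (Δ : Set (Set (NR N))) : Prop :=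
  IsQuasiFan Δ ∧ ∀ σ ∈ Δ, σ ∩ (-σ) = ({0} : Set (NR N))

/-- A system of quasi-fans in the lattice `N`, indexed by `I`. -/
structure SysQFan (N : Type*) [AddCommGroup N] (I : Type*) where
  D : I → I → Set (Set (NR N))
  isQF : ∀ i j, IsQuasiFan (D i j)
  symm : ∀ i j, D i j = D j i
  inter : ∀ i j k, D i j ∩ D j k ⊆ D i k

namespace SysQFan

variable {N : Type*} [AddCommGroup N] {I : Type*}

/-- A system of fans: a system of quasi-fans all of whose members are fans. -/
def IsFanSys (S : SysQFan N I) : Prop := ∀ i j, IsFan (S.D i j)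

/-- An affine system: each `Σ_ii` consists of all the faces of a single cone. -/
def IsAffine (S : SysQFan N I) : Prop := ∀ i, ∃ σ, S.D i i = { τ | IsFaceOf τ σ }

/-- The set `𝔉(S)` of labelled cones of a system of quasi-fans. -/
def LCone (S : SysQFan N I) := { p : Set (NR N) × I // p.1 ∈ S.D p.2 p.2 }

/-- The glueing relation `(σ,i) ∼ (τ,j) ↔ σ = τ ∧ σ ∈ Σ_ij` on labelled cones. -/
def glueSetoid (S : SysQFan N I) : Setoid (LCone S) where
  r p q := p.1.1 = q.1.1 ∧ p.1.1 ∈ S.D p.1.2 q.1.2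
  iseqv := by
    refine ⟨fun p => ⟨rfl, p.2⟩, fun {p q} h => ⟨h.1.symm, ?_⟩,
      fun {p q r} h h' => ⟨h.1.trans h'.1, ?_⟩⟩
    · rw [S.symm, ← h.1]; exact h.2
    · exact S.inter _ _ _ ⟨h.2, by rw [h.1]; exact h'.2⟩

/-- `Ω(S)`: the set of equivalence classes of labelled cones under the glueing relation. -/
def Omega (S : SysQFan N I) := Quotient (glueSetoid S)

/-- The class `[σ,i] ∈ Ω(S)` of a labelled cone `(σ,i)`. -/
def cls {S : SysQFan N I} (p : LCone S) : Omega S := Quotient.mk (glueSetoid S) p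

/-- The partial order on `Ω(S)`:  `[τ,j] ≺ [σ,i]` iff `τ ≺ σ` and `[τ,i] = [τ,j]`. -/
def le (S : SysQFan N I) (a b : Omega S) : Prop :=
  ∃ p q : LCone S, cls p = a ∧ cls q = b ∧ IsFaceOf p.1.1 q.1.1 ∧ p.1.1 ∈ S.D p.1.2 q.1.2

/-- A map of systems of quasi-fans: a lattice homomorphism `F` together with an order
preserving map `f : Ω(S) → Ω(S')` such that `f [σ,i] = [σ',i']` implies
`F_ℝ(σ°) ⊆ (σ')°`. -/
def IsSysMap {N' : Type*} [AddCommGroup N'] {I' : Type*} (S : SysQFan N I)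
    (S' : SysQFan N' I') (F : N →ₗ[ℤ] N') (f : Omega S → Omega S') : Prop :=
  (∀ a b : Omega S, le S a b → le S' (f a) (f b)) ∧
    ∀ (p : LCone S) (q : LCone S'), f (cls p) = cls q →
      (LinearMap.baseChange ℝ F) '' coneRelint p.1.1 ⊆ coneRelint q.1.1

/-- A single quasi-fan, regarded as a system of quasi-fans with one index. -/
def single {N' : Type*} [AddCommGroup N'] (Δ : Set (Set (NR N'))) (h : IsQuasiFan Δ) :
    SysQFan N' PUnit where
  D _ _ := Δ
  isQF _ _ := h
  symm _ _ := rfl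
  inter _ _ _ := fun _ hσ => hσ.1

end SysQFan

/-- A lattice: a finitely generated free `ℤ`-module. -/
structure LatticeData where
  carrier : Type
  [grp : AddCommGroup carrier]
  [free : Module.Free ℤ carrier]
  [fin : Module.Finite ℤ carrier]

attribute [instance] LatticeData.grp LatticeData.free LatticeData.fin

/-- A one-dimensional cone (a ray): it contains a nonzero vector and is contained in a
line through the origin. -/
def OneDim {V : Type*} [AddCommGroup V] [Module ℝ V] (τ : Set V) : Prop :=
  (∃ x ∈ τ, x ≠ (0 : V)) ∧ ∃ x ∈ τ, ∀ y ∈ τ, ∃ c : ℝ, y = c • x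

/-- `τ` is a maximal cone of the collection `D` (with respect to inclusion). -/
def IsMaxConeOf {N : Type*} [AddCommGroup N] (τ : Set (NR N)) (D : Set (Set (NR N))) : Prop :=
  τ ∈ D ∧ ∀ τ' ∈ D, τ ⊆ τ' → τ' = τ

/-- The convex cone generated by a subset `A` of a real vector space. -/
def coneOf {V : Type*} [AddCommGroup V] [Module ℝ V] (A : Set V) : Set V :=
  { x | ∃ (m : ℕ) (u : Fin m → V) (c : Fin m → ℝ),
      (∀ k, u k ∈ A) ∧ (∀ k, 0 ≤ c k) ∧ x = ∑ k, c k • u k }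

/-- The index set `⋃_i R_i` of labelled rays `(ρ,i)` with `ρ` a one-dimensional cone of
`Δ_ii`. -/
def RayIdx {N : Type*} [AddCommGroup N] {I : Type*} (S : SysQFan N I) : Type _ :=
  { q : Set (NR N) × I // q.1 ∈ S.D q.2 q.2 ∧ OneDim q.1 }

/-- The generating set of the cone `σ̃_{(τ,i,j)}` in `Ñ_ℝ = (N ⊕ ⊕_i ℤ^{R_i})_ℝ`: the
canonical basis vectors `e_{(ρ,l)}` with `l ∈ {i,j}` and `ρ` a one-dimensional face of
`τ`. -/
noncomputable def coxGen {N : Type*} [AddCommGroup N] {I : Type*} (S : SysQFan N I)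
    (τ : Set (NR N)) (i j : I) : Set (NR (N × (RayIdx S →₀ ℤ))) :=
  { x | ∃ (l : I) (ρ : Set (NR N)) (h : ρ ∈ S.D l l ∧ OneDim ρ),
      (l = i ∨ l = j) ∧ IsFaceOf ρ τ ∧
      x = toNR ((0, Finsupp.single (⟨(ρ, l), h⟩ : RayIdx S) 1) : N × (RayIdx S →₀ ℤ)) }

/-- Membership in `coneOf A` is membership in the pointed cone spanned by `A`. -/
theorem mem_coneOf_iff {V : Type*} [AddCommGroup V] [Module ℝ V] {A : Set V} {x : V} :
    x ∈ coneOf A ↔ x ∈ PointedCone.hull ℝ A := by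
  constructor
  · rintro ⟨m, u, c, hu, hc, rfl⟩
    exact Submodule.sum_mem _ fun k _ =>
      Submodule.smul_mem _ (⟨c k, hc k⟩ : {c : ℝ // 0 ≤ c}) (Submodule.subset_span (hu k))
  · intro hx
    obtain ⟨m, c, u, rfl⟩ := Submodule.mem_span_set'.1 hx
    exact ⟨m, fun k => u k, fun k => c k, fun k => (u k).2, fun k => (c k).2, rfl⟩

theorem IsConeSet.coneOf_subset {V : Type*} [AddCommGroup V] [Module ℝ V] {A τ : Set V}
    (hτ : IsConeSet τ) (h : A ⊆ τ) : coneOf A ⊆ τ := by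
  rintro _ ⟨m, u, c, hu, hc, rfl⟩
  exact Finset.sum_induction _ (· ∈ τ) (fun a b ha hb => hτ.2.1 a ha b hb) hτ.1
    fun k _ => hτ.2.2 _ (hc k) _ (h (hu k))

theorem IsFaceOf.trans {V : Type*} [AddCommGroup V] [Module ℝ V] {ρ τ σ : Set V}
    (h : IsFaceOf ρ τ) (h' : IsFaceOf τ σ) : IsFaceOf ρ σ := by
  refine ⟨h.1, h.2.1.trans h'.2.1, fun x hx y hy hxy => ?_⟩
  obtain ⟨hx', hy'⟩ := h'.2.2 x hx y hy (h.2.1 hxy)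
  exact h.2.2 x hx' y hy' hxy

/-- The half-line spanned by a vector. -/
def halfLine {V : Type*} [AddCommGroup V] [Module ℝ V] (a : V) : Set V :=
  { x | ∃ c : ℝ, 0 ≤ c ∧ x = c • a }

theorem mem_halfLine_self {V : Type*} [AddCommGroup V] [Module ℝ V] (a : V) : a ∈ halfLine a :=
  ⟨1, zero_le_one, (one_smul ℝ a).symm⟩

theorem isConeSet_halfLine {V : Type*} [AddCommGroup V] [Module ℝ V] (a : V) :
    IsConeSet (halfLine a) := by
  refine ⟨⟨0, le_rfl, (zero_smul ℝ a).symm⟩, ?_, ?_⟩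
  · rintro _ ⟨c, hc, rfl⟩ _ ⟨d, hd, rfl⟩
    exact ⟨c + d, add_nonneg hc hd, (add_smul c d a).symm⟩
  · rintro t ht _ ⟨c, hc, rfl⟩
    exact ⟨t * c, mul_nonneg ht hc, smul_smul t c a⟩

theorem oneDim_halfLine {V : Type*} [AddCommGroup V] [Module ℝ V] {a : V} (ha : a ≠ 0) :
    OneDim (halfLine a) :=
  ⟨⟨a, mem_halfLine_self a, ha⟩, a, mem_halfLine_self a, fun _ ⟨c, _, h⟩ => ⟨c, h⟩⟩

/-- In a strictly convex cone, a generator not lying in the cone spanned by the other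
generators spans a face. -/
theorem isFaceOf_halfLine_of_notMem_hull {V : Type*} [AddCommGroup V] [Module ℝ V] {a : V}
    {s : Set V} (hs : ∀ x ∈ PointedCone.hull ℝ (insert a s),
      ∀ y ∈ PointedCone.hull ℝ (insert a s), x + y = 0 → x = 0)
    (ha : a ∉ PointedCone.hull ℝ s) :
    IsFaceOf (halfLine a) (PointedCone.hull ℝ (insert a s) : Set V) := by
  have hmono : PointedCone.hull ℝ s ≤ PointedCone.hull ℝ (insert a s) :=
    Submodule.span_mono (Set.subset_insert a s)
  have hsub : halfLine a ⊆ (PointedCone.hull ℝ (insert a s) : Set V) := by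
    rintro _ ⟨c, hc, rfl⟩
    exact Submodule.smul_mem _ (⟨c, hc⟩ : {c : ℝ // 0 ≤ c})
      (Submodule.subset_span (Set.mem_insert a s))
  refine ⟨isConeSet_halfLine a, hsub, ?_⟩
  rintro x hx y hy ⟨t, ht, hxy⟩
  obtain ⟨⟨p, hp⟩, x', hx', rfl⟩ := Submodule.mem_span_insert.1 hx
  obtain ⟨⟨q, hq⟩, y', hy', rfl⟩ := Submodule.mem_span_insert.1 hy
  change p • a + x' + (q • a + y') = t • a at hxy
  have hsum : x' + y' = (t - (p + q)) • a := by
    rw [sub_smul, add_smul, ← hxy]; abel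
  have hle : t ≤ p + q := by
    by_contra! hlt
    refine ha ?_
    have h0 : 0 < t - (p + q) := sub_pos.2 hlt
    have : a = (t - (p + q))⁻¹ • (x' + y') := by
      rw [hsum, smul_smul, inv_mul_cancel₀ h0.ne', one_smul]
    rw [this]
    exact Submodule.smul_mem _ (⟨(t - (p + q))⁻¹, (inv_pos.2 h0).le⟩ : {c : ℝ // 0 ≤ c})
      (Submodule.add_mem _ hx' hy')
  have hmem : (p + q - t) • a ∈ PointedCone.hull ℝ (insert a s) :=
    hsub ⟨_, sub_nonneg.2 hle, rfl⟩
  have hzero : x' + y' + (p + q - t) • a = 0 := by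
    rw [hsum, ← add_smul, sub_add_sub_cancel', sub_self, zero_smul]
  have hx0 : x' = 0 := hs _ (hmono hx') _ (Submodule.add_mem _ (hmono hy') hmem)
    (by rw [← add_assoc, hzero])
  have hy0 : y' = 0 := hs _ (hmono hy') _ (Submodule.add_mem _ (hmono hx') hmem)
    (by rw [← add_assoc, add_comm y', hzero])
  exact ⟨⟨p, hp, by rw [hx0, add_zero]; rfl⟩, ⟨q, hq, by rw [hy0, add_zero]; rfl⟩⟩

/-- A strictly convex finitely generated cone is generated by its one-dimensional faces. -/
theorem hull_le_hull_halfLine_faces {V : Type*} [AddCommGroup V] [Module ℝ V] (A : Finset V)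
    (hs : ∀ x ∈ PointedCone.hull ℝ (A : Set V), ∀ y ∈ PointedCone.hull ℝ (A : Set V),
      x + y = 0 → x = 0) :
    PointedCone.hull ℝ (A : Set V) ≤ PointedCone.hull ℝ
      { a | a ≠ 0 ∧ IsFaceOf (halfLine a) (PointedCone.hull ℝ (A : Set V) : Set V) } := by
  classical
  induction A using Finset.strongInduction with
  | H A ih =>
    by_cases h : ∃ a ∈ A, a ∈ PointedCone.hull ℝ ((A.erase a : Finset V) : Set V)
    · obtain ⟨a, haA, ha⟩ := h
      have heq : PointedCone.hull ℝ ((A.erase a : Finset V) : Set V)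
          = PointedCone.hull ℝ (A : Set V) := by
        rw [← Finset.insert_erase haA, Finset.erase_insert (Finset.notMem_erase a A),
          Finset.coe_insert]
        exact (Submodule.span_insert_eq_span ha).symm
      have := ih _ (Finset.erase_ssubset haA) (by rwa [heq])
      rwa [heq] at this
    · push Not at h
      refine Submodule.span_le.2 fun a haA => Submodule.subset_span ⟨?_, ?_⟩
      · rintro rfl
        exact h 0 haA (Submodule.zero_mem _)
      · have hins : (A : Set V) = insert a ((A.erase a : Finset V) : Set V) := by
          rw [← Finset.coe_insert, Finset.insert_erase haA]
        rw [hins] at hs ⊢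
        exact isFaceOf_halfLine_of_notMem_hull hs (h a haA)

theorem IsRatCone.exists_finset_hull {N : Type*} [AddCommGroup N] {γ : Set (NR N)}
    (h : IsRatCone γ) :
    ∃ A : Finset (NR N), γ = (PointedCone.hull ℝ (A : Set (NR N)) : Set (NR N)) := by
  classical
  obtain ⟨m, u, rfl⟩ := h
  refine ⟨Finset.univ.image fun k => toNR (u k), ?_⟩
  ext x
  rw [Finset.coe_image, Finset.coe_univ, Set.image_univ, SetLike.mem_coe, PointedCone.hull,
    Submodule.mem_span_range_iff_exists_fun]
  constructor
  · rintro ⟨c, hc, rfl⟩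
    exact ⟨fun k => ⟨c k, hc k⟩, rfl⟩
  · rintro ⟨c, rfl⟩
    exact ⟨fun k => c k, fun k => (c k).2, rfl⟩

theorem IsRatCone.isConeSet {N : Type*} [AddCommGroup N] {γ : Set (NR N)}
    (h : IsRatCone γ) : IsConeSet γ := by
  obtain ⟨A, rfl⟩ := h.exists_finset_hull
  exact ⟨Submodule.zero_mem _, fun x hx y hy => Submodule.add_mem _ hx hy,
    fun c hc x hx => Submodule.smul_mem _ (⟨c, hc⟩ : {c : ℝ // 0 ≤ c}) hx⟩

/-- A rational ray is the half-line spanned by its primitive generator. -/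
theorem IsRatCone.subset_halfLine {N : Type*} [AddCommGroup N] {ρ : Set (NR N)}
    (h : IsRatCone ρ) {n : N}
    (hn : ∀ w : N, toNR w ∈ ρ → ∃ k : ℕ, toNR w = (k : ℝ) • toNR n) :
    ρ ⊆ halfLine (toNR n) := by
  obtain ⟨m, u, rfl⟩ := h
  rintro _ ⟨c, hc, rfl⟩
  have hL := isConeSet_halfLine (toNR n)
  refine Finset.sum_induction _ (· ∈ halfLine (toNR n)) (fun a b ha hb => hL.2.1 a ha b hb) hL.1
    fun k _ => hL.2.2 _ (hc k) _ ?_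
  obtain ⟨t, ht⟩ := hn (u k) ⟨Pi.single k 1,
    fun l => by by_cases hl : l = k <;> simp [hl], by simp [Pi.single_apply]⟩
  exact ⟨t, Nat.cast_nonneg t, ht⟩

theorem exists_rayIdx_of_mem_coxGen {N : Type*} [AddCommGroup N] {I : Type*} {S : SysQFan N I}
    {τ : Set (NR N)} {i j : I} {x : NR (N × (RayIdx S →₀ ℤ))} (hx : x ∈ coxGen S τ i j) :
    ∃ q : RayIdx S, q.1.2 ∈ ({i, j} : Set I) ∧ IsFaceOf q.1.1 τ ∧
      x = toNR ((0, Finsupp.single q 1) : N × (RayIdx S →₀ ℤ)) := by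
  obtain ⟨l, ρ, h, hl, hρ, he⟩ := hx
  exact ⟨⟨(ρ, l), h⟩, hl, hρ, he⟩

/-- Cones generated by canonical basis vectors with disjoint sets of labels meet only in `0`. -/
theorem eq_zero_of_mem_coneOf_coxGen {N : Type*} [AddCommGroup N] {I : Type*}
    (S : SysQFan N I) {τ τ' : Set (NR N)} {i j i' j' : I}
    (hd : ({i, j} : Set I) ∩ {i', j'} = ∅) {x : NR (N × (RayIdx S →₀ ℤ))}
    (hx : x ∈ coneOf (coxGen S τ i j)) (hx' : x ∈ coneOf (coxGen S τ' i' j')) : x = 0 := by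
  classical
  let P : (N × (RayIdx S →₀ ℤ)) →ₗ[ℤ] (N × (RayIdx S →₀ ℤ)) :=
    LinearMap.inr ℤ N (RayIdx S →₀ ℤ) ∘ₗ
      Finsupp.linearCombination ℤ (fun q : RayIdx S =>
        if q.1.2 ∈ ({i, j} : Set I) then Finsupp.single q (1 : ℤ) else 0) ∘ₗ
      LinearMap.snd ℤ N (RayIdx S →₀ ℤ)
  have hP : ∀ q : RayIdx S, P (0, Finsupp.single q 1)
      = (0, if q.1.2 ∈ ({i, j} : Set I) then Finsupp.single q (1 : ℤ) else 0) := fun q => by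
    simp only [P, LinearMap.comp_apply, LinearMap.snd_apply, LinearMap.inr_apply,
      Finsupp.linearCombination_single, one_smul]
  have h1 : LinearMap.baseChange ℝ P x = x := by
    obtain ⟨m, u, c, hu, -, rfl⟩ := hx
    rw [map_sum]
    refine Finset.sum_congr rfl fun k _ => ?_
    obtain ⟨q, hq, -, he⟩ := exists_rayIdx_of_mem_coxGen (hu k)
    rw [map_smul, he, toNR, LinearMap.baseChange_tmul, hP, if_pos hq]
  have h2 : LinearMap.baseChange ℝ P x = 0 := by
    obtain ⟨m, u, c, hu, -, rfl⟩ := hx'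
    rw [map_sum]
    refine Finset.sum_eq_zero fun k _ => ?_
    obtain ⟨q, hq, -, he⟩ := exists_rayIdx_of_mem_coxGen (hu k)
    have hq' : q.1.2 ∉ ({i, j} : Set I) := fun hm => (hd ▸ ⟨hm, hq⟩ : q.1.2 ∈ (∅ : Set I))
    rw [map_smul, he, toNR, LinearMap.baseChange_tmul, hP, if_neg hq', Prod.mk_zero_zero,
      TensorProduct.tmul_zero, smul_zero]
  rw [← h1, h2]

namespace SysQFan

theorem mem_diag {N : Type*} [AddCommGroup N] {I : Type*} (S : SysQFan N I)
    {τ : Set (NR N)} {i j l : I} (hτ : τ ∈ S.D i j) (hl : l ∈ ({i, j} : Set I)) :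
    τ ∈ S.D i l ∧ τ ∈ S.D l l := by
  have hτ' : τ ∈ S.D j i := S.symm i j ▸ hτ
  rcases hl with rfl | rfl
  · exact ⟨S.inter _ _ _ ⟨hτ, hτ'⟩, S.inter _ _ _ ⟨hτ, hτ'⟩⟩
  · exact ⟨hτ, S.inter _ _ _ ⟨hτ', hτ⟩⟩

end SysQFan

/-- **Lemma 8.1.**  Let `S` be an affine system of fans with `Δ_ii = 𝔉(σ(i))`, let
`v_ρ ∈ N` denote the primitive lattice generator of each occurring ray `ρ`, let
`Ñ := N ⊕ ⊕_{i∈I} ℤ^{R_i}` and let `Q : Ñ → N` be the lattice homomorphism with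
`Q|_N = id` and `Q(e_{(ρ,i)}) = v_ρ`.  For `k = (τ,i,j)` and `k' = (τ',i',j')` in `Ĩ`
(so `i ≤ j`, `i' ≤ j'`, `τ ∈ Δ_ij^max`, `τ' ∈ Δ_{i'j'}^max`):
(a) if `{i,j} ∩ {i',j'} = ∅` then `Q_ℝ(σ̃_k ∩ σ̃_{k'}) = {0} ∈ Δ_{ii'}`;
(b) if `{i,j} ∩ {i',j'} ≠ ∅` then `Q_ℝ(σ̃_k ∩ σ̃_{k'}) = τ ∩ τ' ∈ Δ_{ii'}`. -/
theorem cox_cone_intersections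
    {N : Type} [AddCommGroup N] [Module.Free ℤ N] [Module.Finite ℤ N]
    {I : Type} [Finite I] [LinearOrder I]
    (S : SysQFan N I) (hfan : S.IsFanSys)
    (σ : I → Set (NR N)) (hσ : ∀ i, S.D i i = { τ | IsFaceOf τ (σ i) })
    (h0 : ∀ i j, ({0} : Set (NR N)) ∈ S.D i j)
    (v : Set (NR N) → N)
    (hv : ∀ i, ∀ ρ ∈ S.D i i, OneDim ρ →
      toNR (v ρ) ∈ ρ ∧ ∀ w : N, toNR w ∈ ρ → ∃ n : ℕ, toNR w = (n : ℝ) • toNR (v ρ))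
    (Q : (N × (RayIdx S →₀ ℤ)) →ₗ[ℤ] N)
    (hQ1 : ∀ n : N, Q (n, 0) = n)
    (hQ2 : ∀ q : RayIdx S, Q (0, Finsupp.single q 1) = v q.1.1)
    (τ τ' : Set (NR N)) (i j i' j' : I) (hij : i ≤ j) (hij' : i' ≤ j')
    (hτ : IsMaxConeOf τ (S.D i j)) (hτ' : IsMaxConeOf τ' (S.D i' j')) :
    (({i, j} : Set I) ∩ {i', j'} = ∅ →
      LinearMap.baseChange ℝ Q ''
          (coneOf (coxGen S τ i j) ∩ coneOf (coxGen S τ' i' j'))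
        = ({0} : Set (NR N)) ∧ ({0} : Set (NR N)) ∈ S.D i i') ∧
      (({i, j} : Set I) ∩ {i', j'} ≠ ∅ →
        LinearMap.baseChange ℝ Q ''
            (coneOf (coxGen S τ i j) ∩ coneOf (coxGen S τ' i' j'))
          = τ ∩ τ' ∧ τ ∩ τ' ∈ S.D i i') := by
  have hgen : ∀ q : RayIdx S, LinearMap.baseChange ℝ Q
      (toNR ((0, Finsupp.single q 1) : N × (RayIdx S →₀ ℤ))) = toNR (v q.1.1) := fun q => by
    rw [toNR, LinearMap.baseChange_tmul, hQ2, toNR]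
  have himage : ∀ (κ : Set (NR N)) (a b : I), IsConeSet κ →
      ∀ x ∈ coneOf (coxGen S κ a b), LinearMap.baseChange ℝ Q x ∈ κ := by
    intro κ a b hκ x hx
    have hpre : IsConeSet (LinearMap.baseChange ℝ Q ⁻¹' κ) := by
      refine ⟨?_, fun x hx y hy => ?_, fun c hc x hx => ?_⟩
      · rw [Set.mem_preimage, map_zero]; exact hκ.1
      · rw [Set.mem_preimage, map_add]; exact hκ.2.1 _ hx _ hy
      · rw [Set.mem_preimage, map_smul]; exact hκ.2.2 c hc _ hx
    refine hpre.coneOf_subset ?_ hx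
    intro y hy
    obtain ⟨q, -, hq, rfl⟩ := exists_rayIdx_of_mem_coxGen hy
    rw [Set.mem_preimage, hgen]
    exact hq.2.1 (hv q.1.2 q.1.1 q.2.1 q.2.2).1
  refine ⟨fun hd => ⟨?_, h0 i i'⟩, fun hne => ?_⟩
  · ext y
    constructor
    · rintro ⟨x, ⟨hx, hx'⟩, rfl⟩
      rw [eq_zero_of_mem_coneOf_coxGen S hd hx hx', map_zero]
      rfl
    · rintro rfl
      exact ⟨0, ⟨mem_coneOf_iff.2 (Submodule.zero_mem _), mem_coneOf_iff.2 (Submodule.zero_mem _)⟩,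
        map_zero _⟩
  · obtain ⟨l, hl, hl'⟩ := Set.nonempty_iff_ne_empty.2 hne
    have hτl := (S.mem_diag hτ.1 hl).2
    have hτl' := (S.mem_diag hτ'.1 hl').2
    obtain ⟨hface, hface'⟩ := (S.isQF l l).2.2.2 τ hτl τ' hτl'
    have hmem := S.mem_diag ((S.isQF i j).2.2.1 τ hτ.1 _ hface) hl
    have hmem' := S.mem_diag ((S.isQF i' j').2.2.1 τ' hτ'.1 _ hface') hl'
    refine ⟨Set.Subset.antisymm ?_ ?_, S.inter i l i' ⟨hmem.1, S.symm i' l ▸ hmem'.1⟩⟩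
    · rintro _ ⟨x, ⟨hx, hx'⟩, rfl⟩
      exact ⟨himage τ i j ((S.isQF l l).2.1 τ hτl).isConeSet x hx,
        himage τ' i' j' ((S.isQF l l).2.1 τ' hτl').isConeSet x hx'⟩
    · obtain ⟨A, hA⟩ := ((S.isQF l l).2.1 _ hmem.2).exists_finset_hull
      have hstrict := (hfan l l).2 _ hmem.2
      have hfaces := hull_le_hull_halfLine_faces A (by
        intro x hx y hy hxy
        have hx' : x ∈ τ ∩ τ' := by rw [hA]; exact hx
        have hy' : -x ∈ τ ∩ τ' := by rw [neg_eq_of_add_eq_zero_right hxy, hA]; exact hy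
        have : x ∈ (τ ∩ τ') ∩ -(τ ∩ τ') := ⟨hx', hy'⟩
        rwa [hstrict] at this)
      rw [← hA] at hfaces
      let C : PointedCone ℝ (NR (N × (RayIdx S →₀ ℤ))) :=
        PointedCone.hull ℝ (coxGen S τ i j) ⊓ PointedCone.hull ℝ (coxGen S τ' i' j')
      have hle : PointedCone.hull ℝ { a | a ≠ 0 ∧ IsFaceOf (halfLine a) (τ ∩ τ') }
          ≤ C.map (LinearMap.baseChange ℝ Q) := by
        refine Submodule.span_le.2 ?_
        rintro a ⟨ha, haf⟩
        have hρ : halfLine a ∈ S.D l l := (S.isQF l l).2.2.1 _ hmem.2 _ haf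
        have hdim := oneDim_halfLine ha
        obtain ⟨c, hc, hac⟩ := ((S.isQF l l).2.1 _ hρ).subset_halfLine (hv l _ hρ hdim).2
          (mem_halfLine_self a)
        let q : RayIdx S := ⟨(halfLine a, l), hρ, hdim⟩
        refine ⟨c • toNR ((0, Finsupp.single q 1) : N × (RayIdx S →₀ ℤ)), ?_, ?_⟩
        · exact Submodule.smul_mem C (⟨c, hc⟩ : {c : ℝ // 0 ≤ c})
            ⟨Submodule.subset_span ⟨l, halfLine a, ⟨hρ, hdim⟩, hl, haf.trans hface, rfl⟩,
              Submodule.subset_span ⟨l, halfLine a, ⟨hρ, hdim⟩, hl', haf.trans hface', rfl⟩⟩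
        · exact (map_smul (LinearMap.baseChange ℝ Q) c _).trans ((hgen q).symm ▸ hac.symm)
      intro y hy
      have hyA : y ∈ PointedCone.hull ℝ (A : Set (NR N)) := by
        rw [hA] at hy; exact hy
      obtain ⟨x, hx, hxy⟩ := hle (hfaces hyA)
      exact ⟨x, ⟨mem_coneOf_iff.2 hx.1, mem_coneOf_iff.2 hx.2⟩, hxy⟩
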